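/- Let X be a continuum such that NB*(F₁(X)) is finite. Then S(X) is finite, and NWC(X) = NB(F₁(X)) = NB*(F₁(X)) = S(X). -/

import Mathlib

open Set Filter Metric

/-- `B` does not block `x`: the union of all subcontinua of `X` containing `x`
and contained in the complement of `B` is dense. -/
def NotBlocks {X : Type*} [TopologicalSpace X] (B : Set X) (x : X) : Prop :=
  Dense (⋃₀ {K : Set X | IsCompact K ∧ IsConnected K ∧ x ∈ K ∧ K ⊆ Bᶜ})

/-- The hyperspace `NB(F₁(X))`: nonempty proper closed subsets that do not block
any point of their complement. -/
def NB (X : Type*) [TopologicalSpace X] : Set (Set X) :=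
  {B | B.Nonempty ∧ B ≠ univ ∧ IsClosed B ∧ ∀ x ∉ B, NotBlocks B x}

/-- The hyperspace `NB*(F₁(X))`: nonempty proper closed subsets that do not block
at least one point of their complement. -/
def NBstar (X : Type*) [TopologicalSpace X] : Set (Set X) :=
  {B | B.Nonempty ∧ B ≠ univ ∧ IsClosed B ∧ ∃ x ∉ B, NotBlocks B x}

/-- `F₁(X)`: the one-point subsets of `X`. -/
def F1 (X : Type*) [TopologicalSpace X] : Set (Set X) :=
  {A | ∃ x : X, A = {x}}

/-- `NWC(X)`: nonempty proper closed subsets with empty interior that are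
non-weak cut sets. -/
def NWC (X : Type*) [TopologicalSpace X] : Set (Set X) :=
  {A | A.Nonempty ∧ A ≠ univ ∧ IsClosed A ∧ interior A = ∅ ∧
    ∀ x ∉ A, ∀ y ∉ A, ∃ K : Set X, IsCompact K ∧ IsConnected K ∧ K ⊆ Aᶜ ∧ x ∈ K ∧ y ∈ K}

/-- A shore set: a nonempty proper closed subset `A` such that some sequence of
subcontinua contained in the complement of `A` converges to `X` in the Hausdorff metric. -/
def ShoreSet {X : Type*} [MetricSpace X] (A : Set X) : Prop :=
  A.Nonempty ∧ A ≠ univ ∧ IsClosed A ∧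
    ∃ C : ℕ → Set X, (∀ n, IsCompact (C n) ∧ IsConnected (C n) ∧ C n ⊆ Aᶜ) ∧
      Tendsto (fun n => hausdorffDist (C n) (univ : Set X)) atTop (nhds 0)

/-- `S(X)`: the collection of all shore sets of `X`. -/
def Shore (X : Type*) [MetricSpace X] : Set (Set X) :=
  {A | ShoreSet A}

/-- The composant of a point `z`: the union of all proper subcontinua containing `z`. -/
def composant {X : Type*} [TopologicalSpace X] (z : X) : Set X :=
  ⋃₀ {L : Set X | IsCompact L ∧ IsConnected L ∧ L ≠ univ ∧ z ∈ L}

/-- `X` is irreducible between `p` and `q`: no proper subcontinuum contains both. -/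
def IrrBetween {X : Type*} [TopologicalSpace X] (p q : X) : Prop :=
  ∀ L : Set X, IsCompact L → IsConnected L → p ∈ L → q ∈ L → L = univ

/-- A subcontinuum `K` is decomposable if it is the union of two proper subcontinua. -/
def DecomposableSet {X : Type*} [TopologicalSpace X] (K : Set X) : Prop :=
  ∃ A B : Set X, IsCompact A ∧ IsConnected A ∧ A ⊆ K ∧ A ≠ K ∧
    IsCompact B ∧ IsConnected B ∧ B ⊆ K ∧ B ≠ K ∧ A ∪ B = K

/-- `s(x)` relative to the point `p`: the union of all subcontinua containing `x`
and contained in `X \ {p}`. -/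
def sComp {X : Type*} [TopologicalSpace X] (p x : X) : Set X :=
  ⋃₀ {K : Set X | IsCompact K ∧ IsConnected K ∧ x ∈ K ∧ K ⊆ ({p} : Set X)ᶜ}

section Continua

variable {X : Type*}

/-- Boundary bumping: in a connected compact Hausdorff space, the component of a point in the
complement of a nonempty open set reaches the closure of that open set. -/
theorem connectedComponentIn_compl_inter_closure_nonempty [TopologicalSpace X] [CompactSpace X]
    [T2Space X] [ConnectedSpace X] {U : Set X} (hU : IsOpen U) (hne : U.Nonempty) {x : X}
    (hx : x ∉ U) : (connectedComponentIn Uᶜ x ∩ closure U).Nonempty := by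
  by_contra hempty
  rw [not_nonempty_iff_eq_empty] at hempty
  have hUc : IsClosed Uᶜ := hU.isClosed_compl
  have : CompactSpace ↥(Uᶜ) := isCompact_iff_compactSpace.mp hUc.isCompact
  have hxU : x ∈ Uᶜ := hx
  let O : Set ↥(Uᶜ) := Subtype.val ⁻¹' (closure U)ᶜ
  have hO : IsOpen O := isClosed_closure.isOpen_compl.preimage continuous_subtype_val
  have hsub : ⋂ s : { s : Set ↥(Uᶜ) // IsClopen s ∧ (⟨x, hxU⟩ : ↥(Uᶜ)) ∈ s },
      (s : Set ↥(Uᶜ)) ⊆ O := by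
    rw [← connectedComponent_eq_iInter_isClopen]
    intro z hz hzU
    have : (z : X) ∈ connectedComponentIn Uᶜ x ∩ closure U := by
      refine ⟨?_, hzU⟩
      rw [connectedComponentIn_eq_image hxU]
      exact ⟨z, hz, rfl⟩
    rw [hempty] at this
    exact this
  have : Nonempty { s : Set ↥(Uᶜ) // IsClopen s ∧ (⟨x, hxU⟩ : ↥(Uᶜ)) ∈ s } :=
    ⟨⟨univ, isClopen_univ, mem_univ _⟩⟩
  obtain ⟨⟨D, hD, hxD⟩, hDO⟩ := exists_subset_nhds_of_compactSpace
    (V := fun s : { s : Set ↥(Uᶜ) // IsClopen s ∧ (⟨x, hxU⟩ : ↥(Uᶜ)) ∈ s } =>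
      (s : Set ↥(Uᶜ)))
    (by
      rintro ⟨s, hs, hxs⟩ ⟨t, ht, hxt⟩
      exact ⟨⟨s ∩ t, hs.inter ht, hxs, hxt⟩, inter_subset_left, inter_subset_right⟩)
    (fun s => s.2.1.1) (fun z hz => hO.mem_nhds (hsub hz))
  have hclosed : IsClosed (Subtype.val '' D : Set X) :=
    hUc.isClosedEmbedding_subtypeVal.isClosedMap _ hD.1
  have hopen : IsOpen (Subtype.val '' D : Set X) := by
    obtain ⟨E, hE, hED⟩ := isOpen_induced_iff.mp hD.2
    have : (Subtype.val '' D : Set X) = E ∩ (closure U)ᶜ := by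
      ext z
      constructor
      · rintro ⟨w, hw, rfl⟩
        refine ⟨?_, hDO hw⟩
        rw [← hED] at hw
        exact hw
      · rintro ⟨hzE, hzU⟩
        refine ⟨⟨z, fun h => hzU (subset_closure h)⟩, ?_, rfl⟩
        rw [← hED]
        exact hzE
    rw [this]
    exact hE.inter isClosed_closure.isOpen_compl
  have huniv := IsClopen.eq_univ ⟨hclosed, hopen⟩ ⟨x, ⟨x, hxU⟩, hxD, rfl⟩
  obtain ⟨u, hu⟩ := hne
  obtain ⟨w, -, hw⟩ := huniv.ge (mem_univ u)
  exact w.2 (hw ▸ hu)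

theorem isClosed_connectedComponentIn_of_isClosed [TopologicalSpace X] {F : Set X} {x : X}
    (hF : IsClosed F) (hx : x ∈ F) : IsClosed (connectedComponentIn F x) :=
  isClosed_of_closure_subset <|
    isPreconnected_connectedComponentIn.closure.subset_connectedComponentIn
    (subset_closure (mem_connectedComponentIn hx))
    (closure_minimal (connectedComponentIn_subset F x) hF)

theorem infinite_of_isOpen_of_nonempty [TopologicalSpace X] [T1Space X] [ConnectedSpace X]
    [Nontrivial X] {V : Set X} (hV : IsOpen V) (hne : V.Nonempty) : V.Infinite := by
  obtain ⟨v, hv⟩ := hne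
  exact infinite_of_mem_nhds v (hV.mem_nhds hv)

theorem singleton_mem_NBstar [TopologicalSpace X] [T1Space X] {b x : X} (hbx : x ≠ b)
    (hb : NotBlocks {b} x) : ({b} : Set X) ∈ NBstar X :=
  ⟨singleton_nonempty b, fun h => hbx (h.ge (mem_univ x)), isClosed_singleton, x, hbx, hb⟩

theorem notBlocks_iff [TopologicalSpace X] {B : Set X} {x : X} :
    NotBlocks B x ↔ ∀ V : Set X, IsOpen V → V.Nonempty →
      ∃ K, IsCompact K ∧ IsConnected K ∧ x ∈ K ∧ K ⊆ Bᶜ ∧ (V ∩ K).Nonempty := by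
  unfold NotBlocks
  rw [dense_iff_inter_open]
  refine forall₃_congr fun V _ _ => ⟨?_, ?_⟩
  · rintro ⟨v, hv, K, ⟨h1, h2, h3, h4⟩, hvK⟩
    exact ⟨K, h1, h2, h3, h4, v, hv, hvK⟩
  · rintro ⟨K, h1, h2, h3, h4, v, hv, hvK⟩
    exact ⟨v, hv, K, ⟨h1, h2, h3, h4⟩, hvK⟩

theorem NWC_subset_NB [TopologicalSpace X] : NWC X ⊆ NB X := by
  rintro A ⟨h1, h2, h3, h4, h5⟩
  refine ⟨h1, h2, h3, fun x hx => ?_⟩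
  refine (interior_eq_empty_iff_dense_compl.mp h4).mono fun y hy => ?_
  obtain ⟨K, k1, k2, k3, k4, k5⟩ := h5 x hx y hy
  exact ⟨K, ⟨k1, k2, k4, k3⟩, k5⟩

theorem NB_subset_NBstar [TopologicalSpace X] : NB X ⊆ NBstar X := by
  rintro A ⟨h1, h2, h3, h4⟩
  obtain ⟨x, hx⟩ := (ne_univ_iff_exists_notMem A).mp h2
  exact ⟨h1, h2, h3, x, hx, h4 x hx⟩

theorem NBstar_subset_Shore [MetricSpace X] [CompactSpace X] : NBstar X ⊆ Shore X := by
  rintro A ⟨h1, h2, h3, x, hx, hd⟩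
  refine ⟨h1, h2, h3, ?_⟩
  have key : ∀ n : ℕ, ∃ C : Set X, (IsCompact C ∧ IsConnected C ∧ C ⊆ Aᶜ) ∧
      hausdorffDist C univ ≤ 1 / ((n : ℝ) + 1) := by
    intro n
    have hε : (0 : ℝ) < 1 / ((n : ℝ) + 1) := Nat.one_div_pos_of_nat
    set ε : ℝ := 1 / ((n : ℝ) + 1)
    obtain ⟨t, -, ht, hcov⟩ := finite_cover_balls_of_compact (isCompact_univ (X := X)) (half_pos hε)
    have hK := fun y : X => notBlocks_iff.mp hd (ball y (ε / 2)) isOpen_ball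
      ⟨y, mem_ball_self (half_pos hε)⟩
    choose K k1 k2 k3 k4 k5 using hK
    refine ⟨{x} ∪ ⋃ y ∈ t, K y, ⟨?_, ⟨⟨x, Or.inl rfl⟩, ?_⟩, ?_⟩, ?_⟩
    · exact isCompact_singleton.union (ht.isCompact_biUnion fun y _ => k1 y)
    · have hun : {x} ∪ ⋃ y ∈ t, K y = ⋃₀ insert {x} (K '' t) := by
        rw [sUnion_insert, sUnion_image]
      rw [hun]
      refine isPreconnected_sUnion x _ ?_ ?_
      · rintro s (rfl | ⟨y, -, rfl⟩)
        exacts [rfl, k3 y]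
      · rintro s (rfl | ⟨y, -, rfl⟩)
        exacts [isPreconnected_singleton, (k2 y).isPreconnected]
    · exact union_subset (singleton_subset_iff.mpr hx) (iUnion₂_subset fun y _ => k4 y)
    · refine hausdorffDist_le_of_mem_dist hε.le (fun z _ => ⟨z, mem_univ z, by simpa using hε.le⟩)
        fun z _ => ?_
      obtain ⟨y, hy, hzy⟩ := mem_iUnion₂.mp (hcov (mem_univ z))
      obtain ⟨w, hwy, hwK⟩ := k5 y
      refine ⟨w, Or.inr (mem_iUnion₂.mpr ⟨y, hy, hwK⟩), ?_⟩
      rw [mem_ball] at hzy hwy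
      linarith [dist_triangle_right z w y]
  choose C hC hCn using key
  exact ⟨C, hC, squeeze_zero (fun _ => hausdorffDist_nonneg) hCn
    tendsto_one_div_add_atTop_nhds_zero_nat⟩

theorem eventually_inter_nonempty_of_tendsto_hausdorffDist [MetricSpace X] [CompactSpace X]
    {C : ℕ → Set X} (hne : ∀ n, (C n).Nonempty)
    (hC : Tendsto (fun n => hausdorffDist (C n) (univ : Set X)) atTop (nhds 0))
    {V : Set X} (hV : IsOpen V) (hVne : V.Nonempty) : ∀ᶠ n in atTop, (V ∩ C n).Nonempty := by
  obtain ⟨v, hv⟩ := hVne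
  obtain ⟨ε, hε, hball⟩ := Metric.isOpen_iff.mp hV v hv
  filter_upwards [hC.eventually_lt_const hε] with n hn
  obtain ⟨c, hc, hcv⟩ := exists_dist_lt_of_hausdorffDist_lt' (mem_univ v) hn
    (hausdorffEDist_ne_top_of_nonempty_of_bounded (hne n) ⟨v, mem_univ v⟩
      (isBounded_of_compactSpace) (isBounded_of_compactSpace))
  exact ⟨c, hball hcv, hc⟩

/-- If all proper subcontinua have empty interior, then the points outside a fixed composant are
non-block points, and there are infinitely many of them. -/
theorem infinite_nonblock_of_interior_eq_empty [MetricSpace X] [CompactSpace X] [ConnectedSpace X]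
    [Nontrivial X]
    (hint : ∀ L : Set X, IsCompact L → IsConnected L → L ≠ univ → interior L = ∅) :
    {b : X | ({b} : Set X) ∈ NBstar X}.Infinite := by
  obtain ⟨x⟩ : Nonempty X := inferInstance
  let S : Set (Set X) := {U ∈ TopologicalSpace.countableBasis X | x ∉ U}
  have hS : ∀ U ∈ S, IsOpen U ∧ U.Nonempty := fun U hU =>
    ⟨TopologicalSpace.isOpen_of_mem_countableBasis hU.1,
      TopologicalSpace.nonempty_of_mem_countableBasis hU.1⟩
  have hcl : ∀ U ∈ S, IsClosed (connectedComponentIn Uᶜ x) := fun U hU =>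
    isClosed_connectedComponentIn_of_isClosed (hS U hU).1.isClosed_compl hU.2
  have hcon : ∀ U ∈ S, IsConnected (connectedComponentIn Uᶜ x) := fun U hU =>
    isConnected_connectedComponentIn_iff.mpr hU.2
  have hdense : Dense (⋂ U ∈ S, (connectedComponentIn Uᶜ x)ᶜ) := by
    refine dense_biInter_of_isOpen (fun U hU => (hcl U hU).isOpen_compl)
      ((TopologicalSpace.countable_countableBasis X).mono (sep_subset _ _)) fun U hU => ?_
    refine interior_eq_empty_iff_dense_compl.mp (hint _ (hcl U hU).isCompact (hcon U hU) ?_)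
    intro h
    obtain ⟨u, hu⟩ := (hS U hU).2
    exact connectedComponentIn_subset Uᶜ x (h.ge (mem_univ u)) hu
  have hinf : (⋂ U ∈ S, (connectedComponentIn Uᶜ x)ᶜ).Infinite := by
    intro hfin
    have h := hdense.closure_eq
    rw [hfin.isClosed.closure_eq] at h
    exact infinite_of_isOpen_of_nonempty isOpen_univ ⟨x, mem_univ x⟩ (h ▸ hfin)
  refine (hinf.sdiff (finite_singleton x)).mono ?_
  rintro b ⟨hb, hbx⟩
  refine singleton_mem_NBstar (x := x) (fun h => hbx h.symm) (notBlocks_iff.mpr ?_)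
  intro V hV hVne
  by_cases hxV : x ∈ V
  · exact ⟨{x}, isCompact_singleton, isConnected_singleton, rfl,
      fun z hz hzb => hbx (hzb.symm.trans hz), x, hxV, rfl⟩
  obtain ⟨v, hv⟩ := hVne
  obtain ⟨U, hU, hvU, hUV⟩ := (TopologicalSpace.isBasis_countableBasis X).exists_closure_subset
    (hV.mem_nhds hv)
  have hxU : x ∉ U := fun h => hxV (hUV (subset_closure h))
  have hUS : U ∈ S := ⟨hU, hxU⟩
  obtain ⟨w, hw, hwU⟩ := connectedComponentIn_compl_inter_closure_nonempty (hS U hUS).1 ⟨v, hvU⟩ hxU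
  refine ⟨_, (hcl U hUS).isCompact, hcon U hUS, mem_connectedComponentIn hxU, ?_, w, hUV hwU, hw⟩
  rintro z hz rfl
  exact mem_iInter₂.mp hb U hUS hz

theorem Shore_subset_NBstar [MetricSpace X] [CompactSpace X] [ConnectedSpace X]
    (h : {b : X | ({b} : Set X) ∈ NBstar X}.Finite) : Shore X ⊆ NBstar X := by
  rintro A ⟨h1, h2, h3, C, hC, hlim⟩
  by_contra hA
  have hmeet : ∀ V : Set X, IsOpen V → V.Nonempty → ∀ᶠ n in atTop, (V ∩ C n).Nonempty :=
    fun V hV hVne => eventually_inter_nonempty_of_tendsto_hausdorffDist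
      (fun n => (hC n).2.1.nonempty) hlim hV hVne
  obtain ⟨a, ha⟩ := h1
  obtain ⟨a', ha'⟩ := (ne_univ_iff_exists_notMem A).mp h2
  have : Nontrivial X := ⟨a, a', fun e => ha' (e ▸ ha)⟩
  have havoid : ∀ b : X, ∀ᶠ n in atTop, b ∉ C n := by
    intro b
    by_contra hfreq
    have hfreq : ∃ᶠ n in atTop, b ∈ C n := by simpa [Filter.Frequently] using hfreq
    obtain ⟨m, hm⟩ := hfreq.exists
    refine hA ⟨⟨a, ha⟩, h2, h3, b, (hC m).2.2 hm, notBlocks_iff.mpr fun V hV hVne => ?_⟩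
    obtain ⟨n, hn, hVn⟩ := (hfreq.and_eventually (hmeet V hV hVne)).exists
    exact ⟨C n, (hC n).1, (hC n).2.1, hn, (hC n).2.2, hVn⟩
  refine infinite_nonblock_of_interior_eq_empty (X := X) (fun L hL hLc hLne => ?_) h
  by_contra hint
  rw [← ne_eq, ← nonempty_iff_ne_empty] at hint
  obtain ⟨b, hbL, hb⟩ := ((infinite_of_isOpen_of_nonempty hL.isClosed.isOpen_compl
    (nonempty_compl.mpr hLne)).sdiff h).nonempty
  obtain ⟨l, hl⟩ := hLc.nonempty
  refine hb (singleton_mem_NBstar (x := l) (fun e => hbL (e ▸ hl)) (notBlocks_iff.mpr ?_))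
  intro V hV hVne
  obtain ⟨n, hnb, ⟨z, hzL, hzn⟩, v, hv, hvn⟩ :=
    ((havoid b).and ((hmeet _ isOpen_interior hint).and (hmeet V hV hVne))).exists
  refine ⟨L ∪ C n, hL.union (hC n).1, hLc.union ⟨z, interior_subset hzL, hzn⟩ (hC n).2.1,
    Or.inl hl, ?_, v, hv, Or.inr hvn⟩
  rintro w hw rfl
  exact hw.elim hbL hnb

theorem NBstar_subset_NWC [MetricSpace X] [CompactSpace X] [ConnectedSpace X]
    (h : {b : X | ({b} : Set X) ∈ NBstar X}.Finite) : NBstar X ⊆ NWC X := by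
  rintro A ⟨h1, h2, h3, x, hx, hd⟩
  have hreach : ∀ y ∉ A, ∃ K : Set X, IsCompact K ∧ IsConnected K ∧ x ∈ K ∧ K ⊆ Aᶜ ∧ y ∈ K := by
    intro y hy
    by_contra hK
    have hyA : Aᶜ ∈ nhds y := h3.isOpen_compl.mem_nhds hy
    obtain ⟨F, hF, hFc, hFA⟩ := exists_mem_nhds_isClosed_subset hyA
    have hAF : A ⊆ Fᶜ := fun z hz hzF => hFA hzF hz
    have hyF : y ∉ closure Fᶜ := by
      rw [closure_compl]
      exact fun hn => hn (mem_interior_iff_mem_nhds.mpr hF)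
    have hyF' : y ∉ Fᶜ := fun hn => hyF (subset_closure hn)
    obtain ⟨w, hw, hwF⟩ := connectedComponentIn_compl_inter_closure_nonempty hFc.isOpen_compl
      (h1.mono hAF) hyF'
    rw [compl_compl] at hw
    have hyF'' : y ∈ F := mem_of_mem_nhds hF
    have hcon : IsConnected (connectedComponentIn F y) :=
      isConnected_connectedComponentIn_iff.mpr hyF''
    have hcomp : IsCompact (connectedComponentIn F y) :=
      (isClosed_connectedComponentIn_of_isClosed hFc hyF'').isCompact
    have hinf : (connectedComponentIn F y).Infinite :=
      hcon.isPreconnected.infinite_of_nontrivial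
        ⟨y, mem_connectedComponentIn hyF'', w, hw, fun e => hyF (e ▸ hwF)⟩
    refine hinf (h.subset fun e he => ?_)
    have hmiss : ∀ K : Set X, IsCompact K → IsConnected K → x ∈ K → K ⊆ Aᶜ → e ∉ K := by
      intro K k1 k2 k3 k4 heK
      exact hK ⟨K ∪ connectedComponentIn F y, k1.union hcomp, k2.union ⟨e, heK, he⟩ hcon,
        Or.inl k3, union_subset k4 ((connectedComponentIn_subset F y).trans hFA),
        Or.inr (mem_connectedComponentIn hyF'')⟩
    have hxe : x ≠ e := fun hxe => hmiss {x} isCompact_singleton isConnected_singleton rfl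
      (singleton_subset_iff.mpr hx) hxe.symm
    refine singleton_mem_NBstar hxe (hd.mono (sUnion_subset_sUnion ?_))
    rintro K ⟨k1, k2, k3, k4⟩
    exact ⟨k1, k2, k3, subset_compl_singleton_iff.mpr (hmiss K k1 k2 k3 k4)⟩
  refine ⟨h1, h2, h3, ?_, fun y hy z hz => ?_⟩
  · exact interior_eq_empty_iff_dense_compl.mpr
      (hd.mono (sUnion_subset fun K hK => hK.2.2.2))
  · obtain ⟨K, k1, k2, k3, k4, k5⟩ := hreach y hy
    obtain ⟨L, l1, l2, l3, l4, l5⟩ := hreach z hz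
    exact ⟨K ∪ L, k1.union l1, k2.union ⟨x, k3, l3⟩ l2, union_subset k4 l4, Or.inl k5, Or.inr l5⟩

end Continua

theorem stmt2 (X : Type*) [MetricSpace X] [CompactSpace X] [ConnectedSpace X] [Nonempty X]
    (h : (NBstar X).Finite) :
    (Shore X).Finite ∧ NWC X = NB X ∧ NB X = NBstar X ∧ NBstar X = Shore X := by
  have hpt : {b : X | ({b} : Set X) ∈ NBstar X}.Finite :=
    h.preimage singleton_injective.injOn
  have hS : NBstar X = Shore X := NBstar_subset_Shore.antisymm (Shore_subset_NBstar hpt)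
  have hW := NBstar_subset_NWC hpt
  exact ⟨hS ▸ h, NWC_subset_NB.antisymm (NB_subset_NBstar.trans hW),
    NB_subset_NBstar.antisymm (hW.trans NWC_subset_NB), hS⟩
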